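/- Let q ≥ 1, let R_q = (ℤ/2^q)[v₁, v₂, v₂⁻¹, u] (polynomial in v₁ and u, Laurent in v₂, with ℤ/2^q coefficients), let c : R_q → R_q be the ring involution determined by c(v₁) = −v₁, c(v₂) = −v₂, c(u) = −u, let d(y) = v₂⁻³·(y − c(y)), and let I = (u) be the ideal generated by u. Then d(I) ⊆ I, d∘d = 0 on I, and the homology ker(d|_I)/im(d|_I) is a free module over the ring 𝔽₂[s, t, t⁻¹, P] on the classes of the four elements v₂u, 2^{q−1}u, u², and 2^{q−1}v₂u², where s, t, P act as the classes of v₁v₂⁻³, v₂², and u² respectively. (This is the paper's computation of the first associated-graded differential d_{1,1} for the reduced Bockstein spectral sequence of BZ/(2^q): after d_{1,1}, what remains is ℤ/2[v̂₁, v₂^{±2}, û²]{v₂û, 2^{q−1}û, û², 2^{q−1}v₂û²}.) -/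

import Mathlib

noncomputable section

open LaurentPolynomial

/-- The ring `R_q = (ℤ/2^q)[v₁, v₂, v₂⁻¹, u]`, modeled as Laurent polynomials in
`v₂` over polynomials in the two variables `v₁` and `u` with `ℤ/2^q` coefficients. -/
abbrev BZPage (q : ℕ) : Type := LaurentPolynomial (MvPolynomial (Fin 2) (ZMod (2 ^ q)))

/-- The element `v₁`. -/
def v₁B (q : ℕ) : BZPage q := LaurentPolynomial.C (MvPolynomial.X 0)

/-- The element `u`. -/
def uB (q : ℕ) : BZPage q := LaurentPolynomial.C (MvPolynomial.X 1)

/-- The element `v₂ⁿ` for `n : ℤ`. -/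
def v₂B (q : ℕ) (n : ℤ) : BZPage q := T n

/-- The four generators `v₂u`, `2^{q−1}u`, `u²`, `2^{q−1}v₂u²`. -/
def genB (q : ℕ) : Fin 4 → BZPage q
  | 0 => v₂B q 1 * uB q
  | 1 => (2 ^ (q - 1) : BZPage q) * uB q
  | 2 => uB q ^ 2
  | 3 => (2 ^ (q - 1) : BZPage q) * (v₂B q 1 * uB q ^ 2)

/-- The monomial basis `(v₁v₂⁻³)^a (v₂²)^b (u²)^c · g`, where `g` runs through the
four generators `v₂u`, `2^{q−1}u`, `u²`, `2^{q−1}v₂u²`: these represent an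
`𝔽₂`-basis of the `d_{1,1}`-homology, exhibiting it as a free `𝔽₂[s,t,t⁻¹,P]`-module
on the classes of the four generators, where `s, t, P` act as the classes of
`v₁v₂⁻³, v₂², u²`. -/
def monoB (q : ℕ) : (ℕ × ℤ × ℕ) × Fin 4 → BZPage q := fun x =>
  v₁B q ^ x.1.1 * v₂B q (2 * x.1.2.1 - 3 * (x.1.1 : ℤ)) * uB q ^ (2 * x.1.2.2) *
    genB q x.2

/-- The term `r · v₁^a v₂^n u^k`. -/
def termB (q : ℕ) (n : ℤ) (a k : ℕ) (r : ZMod (2 ^ q)) : BZPage q :=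
  C (MvPolynomial.C r) * (v₁B q ^ a * v₂B q n * uB q ^ k)

/-- The coefficient of `v₁^a v₂^n u^k`. -/
def coeffB (q : ℕ) (n : ℤ) (a k : ℕ) : BZPage q →+ ZMod (2 ^ q) where
  toFun y := MvPolynomial.coeff (Finsupp.single 0 a + Finsupp.single 1 k) (y.coeff n)
  map_zero' := by simp
  map_add' := by simp

lemma coeffB_apply (q : ℕ) (n : ℤ) (a k : ℕ) (y : BZPage q) : coeffB q n a k y =
    MvPolynomial.coeff (Finsupp.single 0 a + Finsupp.single 1 k) (y.coeff n) := rfl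

lemma termB_eq_single (q : ℕ) (n : ℤ) (a k : ℕ) (r : ZMod (2 ^ q)) :
    termB q n a k r = AddMonoidAlgebra.single n
      (MvPolynomial.monomial (Finsupp.single 0 a + Finsupp.single 1 k) r) := by
  rw [LaurentPolynomial.single_eq_C_mul_T, MvPolynomial.monomial_eq,
    Finsupp.prod_add_index' (by simp) (by intros; rw [pow_add])]
  simp only [termB, v₁B, uB, v₂B, map_mul, map_pow, Finsupp.prod_single_index, pow_zero]
  ring

lemma termB_add (q : ℕ) (n : ℤ) (a k : ℕ) (r s : ZMod (2 ^ q)) :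
    termB q n a k (r + s) = termB q n a k r + termB q n a k s := by
  simp only [termB, map_add, add_mul]

lemma termB_zero (q : ℕ) (n : ℤ) (a k : ℕ) : termB q n a k 0 = 0 := by
  simp [termB]

lemma single_add_single_fin_two_inj {a k a' k' : ℕ} :
    (Finsupp.single 0 a + Finsupp.single 1 k : Fin 2 →₀ ℕ) =
      Finsupp.single 0 a' + Finsupp.single 1 k' ↔ a = a' ∧ k = k' := by
  constructor
  · intro h
    have h0 := DFunLike.congr_fun h 0
    have h1 := DFunLike.congr_fun h 1
    simp at h0 h1
    exact ⟨h0, h1⟩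
  · rintro ⟨rfl, rfl⟩
    rfl

lemma coeffB_termB (q : ℕ) (n n' : ℤ) (a k a' k' : ℕ) (r : ZMod (2 ^ q)) :
    coeffB q n a k (termB q n' a' k' r) = if n' = n ∧ a' = a ∧ k' = k then r else 0 := by
  classical
  rw [termB_eq_single, coeffB_apply, AddMonoidAlgebra.coeff_single, Finsupp.single_apply]
  by_cases h : n' = n <;>
    simp [h, MvPolynomial.coeff_monomial, single_add_single_fin_two_inj]

lemma coeffB_T_mul (q : ℕ) (m n : ℤ) (a k : ℕ) (y : BZPage q) :
    coeffB q n a k (v₂B q m * y) = coeffB q (n - m) a k y := by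
  rw [coeffB_apply, coeffB_apply, v₂B, LaurentPolynomial.T,
    AddMonoidAlgebra.coeff_single_mul_apply, one_mul, neg_add_eq_sub]

lemma coeffB_eq_zero_of_mem (q : ℕ) (n : ℤ) (a : ℕ) {y : BZPage q}
    (hy : y ∈ Ideal.span {uB q}) : coeffB q n a 0 y = 0 := by
  obtain ⟨w, rfl⟩ := Ideal.mem_span_singleton'.1 hy
  rw [coeffB_apply, uB, ← LaurentPolynomial.single_eq_C, AddMonoidAlgebra.coeff_mul_single_zero,
    MvPolynomial.coeff_mul_X']
  simp

/-- A predicate closed under addition holds for `y` once it holds for every term of `y`. -/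
lemma of_forall_termB_coeffB {q : ℕ} {p : BZPage q → Prop} (h0 : p 0)
    (hadd : ∀ y z, p y → p z → p (y + z)) (y : BZPage q)
    (h : ∀ n a k, p (termB q n a k (coeffB q n a k y))) : p y := by
  rw [← AddMonoidAlgebra.sum_coeff_single y]
  refine Finset.sum_induction _ p hadd h0 fun n _ => ?_
  rw [MvPolynomial.as_sum (y.coeff n)]
  rw [← AddMonoidAlgebra.singleAddHom_apply, map_sum]
  refine Finset.sum_induction _ p hadd h0 fun m _ => ?_
  have hm : m = Finsupp.single 0 (m 0) + Finsupp.single 1 (m 1) := by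
    ext i
    fin_cases i <;> simp
  have := h n (m 0) (m 1)
  rwa [termB_eq_single, coeffB_apply, ← hm] at this

lemma termB_mem (q : ℕ) (n : ℤ) (a : ℕ) {k : ℕ} (hk : k ≠ 0) (r : ZMod (2 ^ q)) :
    termB q n a k r ∈ Ideal.span {uB q} := by
  rw [Ideal.mem_span_singleton]
  exact ((dvd_pow_self _ hk).mul_left _).mul_left _

section Conjugation

variable {q : ℕ} {c : BZPage q →+* BZPage q}

lemma map_v₂B (hcv₂ : c (v₂B q 1) = -v₂B q 1) (n : ℤ) :
    c (v₂B q n) = ((n.negOnePow : ℤ) : BZPage q) * v₂B q n := by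
  have hT : ∀ m : ℤ, v₂B q (m + 1) = v₂B q m * v₂B q 1 := fun m => T_add m 1
  have hu : IsUnit (v₂B q 1) := isUnit_T 1
  have step : ∀ m : ℤ, c (v₂B q (m + 1)) = ((Int.negOnePow (m + 1) : ℤ) : BZPage q) *
      v₂B q (m + 1) ↔ c (v₂B q m) = ((m.negOnePow : ℤ) : BZPage q) * v₂B q m := by
    intro m
    rw [hT, map_mul, hcv₂, Int.negOnePow_succ, ← hu.mul_left_inj (b := c (v₂B q m))]
    push_cast
    constructor <;> intro h <;> linear_combination -h
  induction n using Int.induction_on with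
  | zero =>
    have : v₂B q 0 = 1 := T_zero
    simp [this]
  | succ i ih => exact (step _).2 ih
  | pred i ih =>
    refine (step _).1 ?_
    simpa using ih

lemma map_termB (hcv₁ : c (v₁B q) = -v₁B q) (hcv₂ : c (v₂B q 1) = -v₂B q 1)
    (hcu : c (uB q) = -uB q) (n : ℤ) (a k : ℕ) (r : ZMod (2 ^ q)) :
    c (termB q n a k r) =
      (((n + a + k).negOnePow : ℤ) : BZPage q) * termB q n a k r := by
  have hr : c (C (MvPolynomial.C r)) = C (MvPolynomial.C r) := by
    rw [← ZMod.natCast_zmod_val r]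
    simp only [map_natCast]
  have hpow : ∀ m : ℕ, (((m : ℤ).negOnePow : ℤ) : BZPage q) = (-1) ^ m := by
    intro m
    rw [Int.negOnePow_def]
    simp
  have hneg : ∀ (y : BZPage q) (m : ℕ), (-y) ^ m = (-1) ^ m * y ^ m := fun y m => neg_pow y m
  simp only [termB, map_mul, map_pow, hr, hcv₁, map_v₂B hcv₂, hcu, Int.negOnePow_add,
    Units.val_mul, Int.cast_mul, hpow]
  rw [hneg (v₁B q), hneg (uB q)]
  ring

lemma coeffB_map (hcv₁ : c (v₁B q) = -v₁B q) (hcv₂ : c (v₂B q 1) = -v₂B q 1)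
    (hcu : c (uB q) = -uB q) (n : ℤ) (a k : ℕ) (y : BZPage q) :
    coeffB q n a k (c y) = ((n + a + k).negOnePow : ℤ) • coeffB q n a k y := by
  refine of_forall_termB_coeffB (p := fun y => coeffB q n a k (c y) =
    ((n + a + k).negOnePow : ℤ) • coeffB q n a k y) (by simp) ?_ y ?_
  · intro y z hy hz
    rw [map_add, map_add, hy, hz, map_add, smul_add]
  · intro n' a' k'
    rw [map_termB hcv₁ hcv₂ hcu, ← zsmul_eq_mul, map_zsmul, coeffB_termB]
    split_ifs with h
    · obtain ⟨rfl, rfl, rfl⟩ := h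
      rfl
    · simp

end Conjugation

lemma ZMod.eq_two_mul_or_eq_one_add_two_mul {q : ℕ} (r : ZMod (2 ^ q)) :
    ∃ x : ZMod (2 ^ q), r = 2 * x ∨ r = 1 + 2 * x := by
  refine ⟨((r.val / 2 : ℕ) : ZMod (2 ^ q)), ?_⟩
  have h := Nat.mod_add_div r.val 2
  have h' : ((r.val % 2 : ℕ) : ZMod (2 ^ q)) + 2 * ((r.val / 2 : ℕ) : ZMod (2 ^ q)) = r := by
    conv_rhs => rw [← ZMod.natCast_zmod_val r, ← h]
    push_cast
    rfl
  rcases Nat.mod_two_eq_zero_or_one r.val with h2 | h2 <;> rw [h2] at h'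
  · left
    simpa using h'.symm
  · right
    simpa using h'.symm

lemma ZMod.eq_zero_or_of_two_mul_eq_zero {q : ℕ} (hq : 1 ≤ q) {r : ZMod (2 ^ q)}
    (h : 2 * r = 0) : r = 0 ∨ r = 2 ^ (q - 1) := by
  obtain ⟨p, rfl⟩ : ∃ p, q = p + 1 := ⟨q - 1, by omega⟩
  have hlt := ZMod.val_lt r
  have hdvd : 2 ^ (p + 1) ∣ 2 * r.val := by
    rw [← ZMod.natCast_eq_zero_iff]
    simpa using h
  obtain ⟨t, ht⟩ : 2 ^ p ∣ r.val :=
    Nat.dvd_of_mul_dvd_mul_left two_pos (by rwa [← pow_succ'])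
  have ht2 : t < 2 := by
    have hlt' : 2 ^ p * t < 2 ^ p * 2 := by rwa [← ht, ← pow_succ]
    exact lt_of_mul_lt_mul_left hlt' (by positivity)
  rw [← ZMod.natCast_zmod_val r, ht]
  interval_cases t <;> simp

lemma ZMod.two_mul_two_pow_pred {q : ℕ} (hq : 1 ≤ q) :
    (2 : ZMod (2 ^ q)) * 2 ^ (q - 1) = 0 := by
  rw [← pow_succ', Nat.sub_add_cancel hq]
  exact_mod_cast ZMod.natCast_self (2 ^ q)

lemma ZMod.two_pow_pred_ne_zero {q : ℕ} (hq : 1 ≤ q) : (2 : ZMod (2 ^ q)) ^ (q - 1) ≠ 0 := by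
  intro h
  have h' : ((2 ^ (q - 1) : ℕ) : ZMod (2 ^ q)) = 0 := by exact_mod_cast h
  rw [ZMod.natCast_eq_zero_iff, Nat.pow_dvd_pow_iff_le_right (by norm_num)] at h'
  omega

lemma ZMod.two_mul_ne_one {q : ℕ} (hq : 1 ≤ q) (x : ZMod (2 ^ q)) : 2 * x ≠ 1 := by
  intro h
  apply ZMod.two_pow_pred_ne_zero hq
  rw [← mul_one ((2 : ZMod (2 ^ q)) ^ (q - 1)), ← h]
  linear_combination x * ZMod.two_mul_two_pow_pred hq

/-- The `v₂`-exponent of `monoB`. -/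
def v₂ExpB (x : (ℕ × ℤ × ℕ) × Fin 4) : ℤ :=
  2 * x.1.2.1 - 3 * (x.1.1 : ℤ) + if x.2 = 0 ∨ x.2 = 3 then 1 else 0

/-- The `u`-exponent of `monoB`. -/
def uExpB (x : (ℕ × ℤ × ℕ) × Fin 4) : ℕ :=
  2 * x.1.2.2 + if x.2 = 0 ∨ x.2 = 1 then 1 else 2

/-- The coefficient of `monoB`. -/
def scalarB (q : ℕ) (x : (ℕ × ℤ × ℕ) × Fin 4) : ZMod (2 ^ q) :=
  if x.2 = 0 ∨ x.2 = 2 then 1 else 2 ^ (q - 1)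

lemma monoB_eq_termB (q : ℕ) (x : (ℕ × ℤ × ℕ) × Fin 4) :
    monoB q x = termB q (v₂ExpB x) x.1.1 (uExpB x) (scalarB q x) := by
  obtain ⟨⟨a, b, k⟩, i⟩ := x
  have hT : ∀ m n : ℤ, v₂B q (m + n) = v₂B q m * v₂B q n := fun m n => T_add m n
  have hT0 : v₂B q 0 = 1 := T_zero
  have h2 : (C (MvPolynomial.C 2) : BZPage q) = 2 := by simp only [map_ofNat]
  fin_cases i <;>
    simp only [monoB, genB, termB, v₂ExpB, uExpB, scalarB, hT, pow_add] <;>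
    simp [h2, hT0] <;> ring

lemma exponents_injective {x y : (ℕ × ℤ × ℕ) × Fin 4} (h1 : v₂ExpB x = v₂ExpB y)
    (h2 : x.1.1 = y.1.1) (h3 : uExpB x = uExpB y) : x = y := by
  obtain ⟨⟨a, b, k⟩, i⟩ := x
  obtain ⟨⟨a', b', k'⟩, i'⟩ := y
  simp only [v₂ExpB, uExpB] at h1 h2 h3
  fin_cases i <;> fin_cases i' <;> simp at h1 h3 ⊢ <;> omega

lemma uExpB_ne_zero (x : (ℕ × ℤ × ℕ) × Fin 4) : uExpB x ≠ 0 := by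
  unfold uExpB
  split_ifs <;> omega

lemma even_exponents_iff (x : (ℕ × ℤ × ℕ) × Fin 4) :
    Even (v₂ExpB x + x.1.1 + uExpB x) ↔ x.2 = 0 ∨ x.2 = 2 := by
  obtain ⟨⟨a, b, k⟩, i⟩ := x
  rw [Int.even_iff]
  fin_cases i <;> simp [v₂ExpB, uExpB] <;> omega

/-- Up to the scalar, every term divisible by `u` is of the form `monoB`. -/
lemma exists_exponents (n : ℤ) (a : ℕ) {k : ℕ} (hk : k ≠ 0) :
    ∃ x, v₂ExpB x = n ∧ x.1.1 = a ∧ uExpB x = k := by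
  rcases Int.even_or_odd' (n + 3 * a) with ⟨b, hb | hb⟩ <;>
  rcases Nat.even_or_odd' (k - 1) with ⟨l, hl | hl⟩
  · exact ⟨((a, b, l), 1), by simp [v₂ExpB]; omega, rfl, by simp [uExpB]; omega⟩
  · exact ⟨((a, b, l), 2), by simp [v₂ExpB]; omega, rfl, by simp [uExpB]; omega⟩
  · exact ⟨((a, b, l), 0), by simp [v₂ExpB]; omega, rfl, by simp [uExpB]; omega⟩
  · exact ⟨((a, b, l), 3), by simp [v₂ExpB]; omega, rfl, by simp [uExpB]; omega⟩

lemma Finset.sum_add_sum_eq_sum_symmDiff_add_two_mul {ι R : Type*} [DecidableEq ι] [CommRing R]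
    (s t : Finset ι) (f : ι → R) :
    ∑ i ∈ s, f i + ∑ i ∈ t, f i = ∑ i ∈ symmDiff s t, f i + 2 * ∑ i ∈ s ∩ t, f i := by
  have hst : Disjoint (s \ t) (t \ s) := disjoint_sdiff_sdiff
  rw [symmDiff_def, Finset.sup_eq_union, Finset.sum_union hst,
    ← Finset.sum_inter_add_sum_sdiff s t, ← Finset.sum_inter_add_sum_sdiff t s,
    Finset.inter_comm t s]
  ring

set_option synthInstance.maxHeartbeats 1000000 in
set_option maxHeartbeats 2000000 in
/-- Let `q ≥ 1`, let `R_q = (ℤ/2^q)[v₁, v₂, v₂⁻¹, u]`, let `c`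
be the ring involution with `c(v₁) = −v₁`, `c(v₂) = −v₂`, `c(u) = −u`, let
`d(y) = v₂⁻³·(y − c(y))`, and let `I = (u)`.  Then `d(I) ⊆ I`, `d∘d = 0` on `I`,
and the homology `ker(d|_I)/im(d|_I)` is a free module over `𝔽₂[s,t,t⁻¹,P]` on
the classes of the four elements `v₂u`, `2^{q−1}u`, `u²`, `2^{q−1}v₂u²` (with
`s, t, P` acting as the classes of `v₁v₂⁻³`, `v₂²`, `u²`): the classes of the
elements `monoB q x` form an `𝔽₂`-basis of the homology. -/
theorem bockstein_d11_BZtwoq (q : ℕ) (hq : 1 ≤ q)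
    (c : BZPage q →+* BZPage q) (hinv : ∀ y, c (c y) = y)
    (hcv₁ : c (v₁B q) = -v₁B q) (hcv₂ : c (v₂B q 1) = -v₂B q 1)
    (hcu : c (uB q) = -uB q) :
    let d : BZPage q → BZPage q := fun y => v₂B q (-3) * (y - c y)
    let I : Ideal (BZPage q) := Ideal.span {uB q}
    (∀ y ∈ I, d y ∈ I) ∧
    (∀ y ∈ I, d (d y) = 0) ∧
    (∀ x, monoB q x ∈ I ∧ d (monoB q x) = 0) ∧
    (∀ y ∈ I, d y = 0 →
      ∃ S : Finset ((ℕ × ℤ × ℕ) × Fin 4), ∃ z ∈ I, y - ∑ s ∈ S, monoB q s = d z) ∧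
    (∀ y ∈ I, d y = 0 → ∃ z ∈ I, 2 * y = d z) ∧
    (∀ S : Finset ((ℕ × ℤ × ℕ) × Fin 4),
      (∃ z ∈ I, ∑ s ∈ S, monoB q s = d z) → S = ∅) := by
  intro d I
  have hcT : c (v₂B q (-3)) = -v₂B q (-3) := by
    rw [map_v₂B hcv₂, show Int.negOnePow (-3) = -1 from rfl]
    push_cast
    ring
  have hcT' : c (v₂B q 3) = -v₂B q 3 := by
    rw [map_v₂B hcv₂, show Int.negOnePow 3 = -1 from rfl]
    push_cast
    ring
  have hTT : v₂B q (-3) * v₂B q 3 = 1 := by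
    rw [v₂B, v₂B, ← T_add]
    exact T_zero
  have hd_add : ∀ y z, d (y + z) = d y + d z := by
    intro y z
    simp only [d, map_add]
    ring
  have hcI : ∀ y ∈ I, c y ∈ I := by
    intro y hy
    obtain ⟨w, rfl⟩ := Ideal.mem_span_singleton'.1 hy
    rw [map_mul, hcu]
    exact Ideal.mem_span_singleton'.2 ⟨-c w, by ring⟩
  have hcoeff : ∀ n a k y, coeffB q n a k (d y) =
      coeffB q (n + 3) a k y + ((n + a + k).negOnePow : ℤ) • coeffB q (n + 3) a k y := by
    intro n a k y
    simp only [d]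
    rw [coeffB_T_mul, map_sub, coeffB_map hcv₁ hcv₂ hcu, sub_neg_eq_add,
      show n + 3 + a + k = n + a + k + 3 by ring, Int.negOnePow_add,
      show Int.negOnePow 3 = -1 from rfl]
    push_cast
    ring
  have hker_smul : ∀ y, d y = 0 → c y = y := by
    intro y hy
    have : v₂B q 3 * d y = y - c y := by
      simp only [d]
      linear_combination (y - c y) * hTT
    rw [hy, mul_zero] at this
    exact (sub_eq_zero.1 this.symm).symm
  have htwo : ∀ y, c y = y → 2 * y = d (v₂B q 3 * y) := by
    intro y hy
    simp only [d, map_mul, hcT', hy]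
    linear_combination (-2 * y) * hTT
  have hmono : ∀ x, monoB q x ∈ I ∧ c (monoB q x) = monoB q x := by
    intro x
    rw [monoB_eq_termB]
    refine ⟨termB_mem _ _ _ (uExpB_ne_zero x) _, ?_⟩
    rw [map_termB hcv₁ hcv₂ hcu]
    by_cases hx : x.2 = 0 ∨ x.2 = 2
    · simp [Int.negOnePow_even _ ((even_exponents_iff x).2 hx)]
    · rw [Int.negOnePow_odd _ (Int.not_even_iff_odd.1 fun h => hx ((even_exponents_iff x).1 h)),
        scalarB, if_neg hx]
      have h2 : termB q (v₂ExpB x) x.1.1 (uExpB x) (2 ^ (q - 1)) +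
          termB q (v₂ExpB x) x.1.1 (uExpB x) (2 ^ (q - 1)) = 0 := by
        rw [← termB_add, ← two_mul, ZMod.two_mul_two_pow_pred hq, termB_zero]
      push_cast
      linear_combination -h2
  have hd_of_fixed : ∀ y, c y = y → d y = 0 := by
    intro y hy
    simp only [d, hy, sub_self, mul_zero]
  refine ⟨fun y hy => I.mul_mem_left _ (I.sub_mem hy (hcI y hy)), ?_,
    fun x => ⟨(hmono x).1, hd_of_fixed _ (hmono x).2⟩, ?_,
    fun y hy h => ⟨_, I.mul_mem_left _ hy, htwo y (hker_smul y h)⟩, ?_⟩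
  · intro y _
    apply hd_of_fixed
    simp only [d, map_mul, map_sub, hcT, hinv]
    ring
  · intro y hy hdy
    classical
    refine of_forall_termB_coeffB (p := fun y => ∃ S : Finset ((ℕ × ℤ × ℕ) × Fin 4),
      ∃ z ∈ I, y - ∑ s ∈ S, monoB q s = d z) ⟨∅, 0, I.zero_mem, by simp [d]⟩ ?_ y ?_
    · rintro y₁ y₂ ⟨S₁, z₁, hz₁, h₁⟩ ⟨S₂, z₂, hz₂, h₂⟩
      refine ⟨symmDiff S₁ S₂, z₁ + z₂ + v₂B q 3 * ∑ s ∈ S₁ ∩ S₂, monoB q s,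
        I.add_mem (I.add_mem hz₁ hz₂)
          (I.mul_mem_left _ (I.sum_mem fun s _ => (hmono s).1)), ?_⟩
      rw [hd_add, hd_add, ← h₁, ← h₂, ← htwo]
      · linear_combination
          Finset.sum_add_sum_eq_sum_symmDiff_add_two_mul S₁ S₂ (monoB q)
      · rw [map_sum]
        exact Finset.sum_congr rfl fun s _ => (hmono s).2
    · intro n a k
      have hzero : ∃ S : Finset ((ℕ × ℤ × ℕ) × Fin 4), ∃ z ∈ I,
          (0 : BZPage q) - ∑ s ∈ S, monoB q s = d z :=
        ⟨∅, 0, I.zero_mem, by simp [d]⟩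
      rcases eq_or_ne k 0 with rfl | hk
      · rw [coeffB_eq_zero_of_mem q n a hy, termB_zero]
        exact hzero
      obtain ⟨x, rfl, rfl, rfl⟩ := exists_exponents n a hk
      have hfix := coeffB_map hcv₁ hcv₂ hcu (v₂ExpB x) x.1.1 (uExpB x) y
      rw [hker_smul y hdy] at hfix
      set r := coeffB q (v₂ExpB x) x.1.1 (uExpB x) y
      by_cases hx : x.2 = 0 ∨ x.2 = 2
      · have hsplit : ∀ t, termB q (v₂ExpB x) x.1.1 (uExpB x) (2 * t) =
            d (v₂B q 3 * termB q (v₂ExpB x) x.1.1 (uExpB x) t) := by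
          intro t
          rw [two_mul, termB_add, ← two_mul]
          apply htwo
          rw [map_termB hcv₁ hcv₂ hcu,
            Int.negOnePow_even _ ((even_exponents_iff x).2 hx)]
          simp
        have hmem := fun t => I.mul_mem_left (v₂B q 3)
          (termB_mem q (v₂ExpB x) x.1.1 (uExpB_ne_zero x) t)
        obtain ⟨t, ht | ht⟩ := ZMod.eq_two_mul_or_eq_one_add_two_mul r
        · exact ⟨∅, _, hmem t, by rw [Finset.sum_empty, sub_zero, ht, hsplit]⟩
        · refine ⟨{x}, _, hmem t, ?_⟩
          rw [Finset.sum_singleton, monoB_eq_termB, scalarB, if_pos hx, ht, termB_add, hsplit,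
            add_sub_cancel_left]
      · rw [Int.negOnePow_odd _ (Int.not_even_iff_odd.1 fun h =>
          hx ((even_exponents_iff x).1 h))] at hfix
        have h2 : 2 * r = 0 := by
          simp only [Units.val_neg, Units.val_one, neg_smul, one_smul] at hfix
          linear_combination hfix
        rcases ZMod.eq_zero_or_of_two_mul_eq_zero hq h2 with hr | hr
        · rw [hr, termB_zero]
          exact hzero
        · refine ⟨{x}, 0, I.zero_mem, ?_⟩
          rw [Finset.sum_singleton, monoB_eq_termB, scalarB, if_neg hx, hr, sub_self]
          simp [d]
  · rintro S ⟨z, -, hz⟩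
    rw [Finset.eq_empty_iff_forall_notMem]
    intro x hxS
    have h := congrArg (coeffB q (v₂ExpB x) x.1.1 (uExpB x)) hz
    rw [map_sum, Finset.sum_eq_single_of_mem x hxS, hcoeff, monoB_eq_termB, coeffB_termB,
      if_pos ⟨rfl, rfl, rfl⟩] at h
    · by_cases hx : x.2 = 0 ∨ x.2 = 2
      · rw [scalarB, if_pos hx, Int.negOnePow_even _ ((even_exponents_iff x).2 hx), Units.val_one,
          one_smul, ← two_mul] at h
        exact ZMod.two_mul_ne_one hq _ h.symm
      · rw [scalarB, if_neg hx, Int.negOnePow_odd _ (Int.not_even_iff_odd.1 fun h =>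
          hx ((even_exponents_iff x).1 h))] at h
        simp only [Units.val_neg, Units.val_one, neg_smul, one_smul, add_neg_cancel] at h
        exact ZMod.two_pow_pred_ne_zero hq h
    · intro y _ hyx
      rw [monoB_eq_termB, coeffB_termB, if_neg]
      rintro ⟨h1, h2, h3⟩
      exact hyx (exponents_injective h1 h2 h3)
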